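/- arXiv:1106.0339 — 3 statements merged into one kernel-verified Lean document; each statement's English description precedes it below -/
import Mathlib

section
/- Suppose m, μ > 1 are integers, p, q ∈ (0,∞), and a is a sequence with a ∈ 𝔄̂_{m,p} and a ∈ 𝔄̂_{μ,q}. Then a ∈ 𝔄̂_{d+1,r}, where d = gcd(m-1, μ-1) and r = (d/(m-1))·p. -/
/-- The `m`-th iterated forward difference of a real sequence, evaluated at `n`:
`(D^m a)_n = ∑_{k=0}^{m} (-1)^k (m choose k) a_{n+k}`. -/
def Dseq (a : ℕ → ℝ) (m n : ℕ) : ℝ :=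
  ∑ k ∈ Finset.range (m + 1), (-1 : ℝ) ^ k * (m.choose k : ℝ) * a (n + k)

/-- `a ∈ 𝔄_{m,p}`: a nonnegative sequence with `D^m (a^p) = 0`. -/
def MemA (a : ℕ → ℝ) (m : ℕ) (p : ℝ) : Prop :=
  (∀ n, 0 ≤ a n) ∧ ∀ n, Dseq (fun j => a j ^ p) m n = 0

/-- `a ∈ 𝔄̂_{m,p}`: `a ∈ 𝔄_{m,p}` and `D^{m-1} (a^p) ≠ 0`. -/
def MemAhat (a : ℕ → ℝ) (m : ℕ) (p : ℝ) : Prop :=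
  MemA a m p ∧ ¬ ∀ n, Dseq (fun j => a j ^ p) (m - 1) n = 0

open Polynomial Filter Topology

lemma Dseq_eq (f : ℕ → ℝ) (m n : ℕ) : Dseq f m n = (-1) ^ m * ((fwdDiff 1)^[m] f n) := by
  rw [fwdDiff_iter_eq_sum_shift, Dseq, Finset.mul_sum]
  refine Finset.sum_congr rfl fun k hk => ?_
  have hk' : k ≤ m := by simp at hk; omega
  obtain ⟨j, rfl⟩ := Nat.exists_eq_add_of_le hk'
  have h1 : ((-1 : ℝ) ^ j) * (-1) ^ j = 1 := by
    rw [← mul_pow]; simp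
  simp only [Nat.add_sub_cancel_left, zsmul_eq_mul, smul_eq_mul, mul_one]
  push_cast
  rw [pow_add]
  linear_combination (-(-1 : ℝ) ^ k * ((k + j).choose k : ℝ) * f (n + k)) * h1

lemma Dseq_poly (P : ℝ[X]) (k : ℕ) (hP : P.degree < k) (n : ℕ) :
    Dseq (fun j => P.eval (j : ℝ)) k n = 0 := by
  by_cases h0 : P = 0
  · simp [h0, Dseq]
  have h := congrFun (Polynomial.fwdDiff_iter_eq_zero_of_degree_lt
    ((natDegree_lt_iff_degree_lt h0).2 hP)) (n : ℝ)
  rw [fwdDiff_iter_eq_sum_shift] at h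
  rw [Dseq_eq, fwdDiff_iter_eq_sum_shift]
  simp only [smul_eq_mul, mul_one, nsmul_eq_mul, Pi.zero_apply, Nat.cast_id] at h ⊢
  push_cast
  rw [h, mul_zero]

lemma exists_poly (f : ℕ → ℝ) (k : ℕ) (h : ∀ n, Dseq f k n = 0) :
    ∃ P : ℝ[X], P.degree < k ∧ ∀ n : ℕ, f n = P.eval (n : ℝ) := by
  have hk : (fwdDiff 1)^[k] f = 0 := by
    funext n
    have := h n
    rw [Dseq_eq] at this
    simpa using this
  have hz : ∀ j, k ≤ j → (fwdDiff 1)^[j] f 0 = 0 := by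
    intro j hj
    obtain ⟨i, rfl⟩ := Nat.exists_eq_add_of_le' hj
    rw [Function.iterate_add_apply, hk, fwdDiff_iter_eq_sum_shift]
    simp
  refine ⟨∑ j ∈ Finset.range k, C ((fwdDiff 1)^[j] f 0 / (j.factorial : ℝ)) * descPochhammer ℝ j, ?_, ?_⟩
  · rw [← mem_degreeLT]
    refine Submodule.sum_mem _ fun j hj => ?_
    rw [mem_degreeLT]
    rw [← smul_eq_C_mul]
    refine lt_of_le_of_lt (degree_smul_le _ _) ?_
    refine lt_of_le_of_lt degree_le_natDegree ?_
    rw [descPochhammer_natDegree]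
    exact_mod_cast Finset.mem_range.1 hj
  · intro n
    have := shift_eq_sum_fwdDiff_iter 1 f n 0
    simp only [zero_add, smul_eq_mul, mul_one, nsmul_eq_mul] at this
    rw [this, eval_finset_sum]
    have e1 : ∑ j ∈ Finset.range (n + 1), (n.choose j : ℝ) * (fwdDiff 1)^[j] f 0
        = ∑ j ∈ Finset.range (n + 1 + k), (n.choose j : ℝ) * (fwdDiff 1)^[j] f 0 := by
      refine Finset.sum_subset (by simp) fun j _ hj => ?_
      rw [Nat.choose_eq_zero_of_lt (by simp at hj; omega)]; simp
    have e2 : ∑ j ∈ Finset.range k, (n.choose j : ℝ) * (fwdDiff 1)^[j] f 0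
        = ∑ j ∈ Finset.range (n + 1 + k), (n.choose j : ℝ) * (fwdDiff 1)^[j] f 0 := by
      refine Finset.sum_subset (by intro x; simp; omega) fun j _ hj => ?_
      rw [hz j (by simpa using hj)]; simp
    rw [e1, ← e2]
    refine Finset.sum_congr rfl fun j _ => ?_
    rw [Nat.cast_choose_eq_descPochhammer_div, eval_mul, eval_C]
    ring

lemma poly_ext (P Q : ℝ[X]) (h : ∀ n : ℕ, P.eval (n : ℝ) = Q.eval (n : ℝ)) : P = Q := by
  refine Polynomial.eq_of_infinite_eval_eq P Q ?_
  refine (Set.infinite_range_of_injective (Nat.cast_injective (R := ℝ))).mono ?_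
  rintro _ ⟨n, rfl⟩
  exact h n

lemma hat_iff (f : ℕ → ℝ) (k : ℕ) :
    ((∀ n, Dseq f (k + 1) n = 0) ∧ ¬ ∀ n, Dseq f k n = 0) ↔
    ∃ P : ℝ[X], P.degree = k ∧ ∀ n : ℕ, f n = P.eval (n : ℝ) := by
  constructor
  · rintro ⟨h1, h2⟩
    obtain ⟨P, hP, hf⟩ := exists_poly f _ h1
    refine ⟨P, le_antisymm ?_ ?_, hf⟩
    · exact Order.le_of_lt_succ (by exact_mod_cast hP)
    · by_contra hlt
      apply h2
      rw [funext hf]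
      exact Dseq_poly P k (not_le.1 hlt)
  · rintro ⟨P, hP, hf⟩
    refine ⟨?_, fun h => ?_⟩
    · rw [funext hf]
      refine Dseq_poly P _ ?_
      rw [hP]; exact_mod_cast Nat.lt_succ_self k
    · obtain ⟨Q, hQ, hf'⟩ := exists_poly f _ h
      have : P = Q := poly_ext _ _ fun n => by rw [← hf, ← hf']
      rw [← this, hP] at hQ
      exact lt_irrefl _ hQ

lemma asymp (P : ℝ[X]) (k : ℕ) (hP : P.degree = k) (h : ∀ n : ℕ, 0 ≤ P.eval (n : ℝ)) :
    0 < P.leadingCoeff ∧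
      Tendsto (fun n : ℕ => P.eval (n : ℝ) / (n : ℝ) ^ k) atTop (𝓝 P.leadingCoeff) := by
  have h1 := (div_tendsto_atTop_leadingCoeff_div_of_degree_eq P (X ^ k : ℝ[X])
    (by rw [hP, degree_X_pow])).comp tendsto_natCast_atTop_atTop
  have h2 : Tendsto (fun n : ℕ => P.eval (n : ℝ) / (n : ℝ) ^ k) atTop (𝓝 P.leadingCoeff) := by
    simpa [Function.comp_def] using h1
  refine ⟨lt_of_le_of_ne (ge_of_tendsto' h2 fun n => div_nonneg (h n) (by positivity)) ?_, h2⟩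
  intro h0
  rw [eq_comm, leadingCoeff_eq_zero] at h0
  simp [h0] at hP

lemma asymp_rpow (a : ℕ → ℝ) (ha : ∀ n, 0 ≤ a n) (p s : ℝ) (P : ℝ[X]) (k : ℕ)
    (hP : P.degree = k) (hf : ∀ n : ℕ, a n ^ p = P.eval (n : ℝ)) :
    ∃ c > 0, Tendsto (fun n : ℕ => a n ^ (p * s) / (n : ℝ) ^ (k * s)) atTop (𝓝 c) := by
  obtain ⟨h1, h2⟩ := asymp P k hP fun n => by rw [← hf]; exact Real.rpow_nonneg (ha n) _
  refine ⟨P.leadingCoeff ^ s, Real.rpow_pos_of_pos h1 _, ?_⟩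
  refine (h2.rpow_const (p := s) (Or.inl h1.ne')).congr fun n => ?_
  rw [← hf, Real.div_rpow (Real.rpow_nonneg (ha n) _) (by positivity), ← Real.rpow_mul (ha n),
    Real.rpow_mul (Nat.cast_nonneg n), Real.rpow_natCast]

lemma exponent_aux (u v : ℝ) (x : ℕ → ℝ) (c d : ℝ) (hc : 0 < c) (hd : 0 < d)
    (h1 : Tendsto (fun n : ℕ => x n / (n : ℝ) ^ u) atTop (𝓝 c))
    (h2 : Tendsto (fun n : ℕ => x n / (n : ℝ) ^ v) atTop (𝓝 d)) : u ≤ v := by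
  by_contra! hlt
  have h3 : Tendsto (fun n : ℕ => (n : ℝ) ^ (u - v)) atTop atTop :=
    (tendsto_rpow_atTop (sub_pos.2 hlt)).comp tendsto_natCast_atTop_atTop
  have h4 := h3.atTop_mul_pos hc h1
  refine not_tendsto_nhds_of_tendsto_atTop h4 d (h2.congr' ?_)
  filter_upwards [eventually_gt_atTop 0] with n hn
  have hn' : (0 : ℝ) < n := by exact_mod_cast hn
  rw [Real.rpow_sub hn']
  have := (Real.rpow_pos_of_pos hn' u).ne'
  have := (Real.rpow_pos_of_pos hn' v).ne'
  field_simp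

lemma exists_root (P Q : ℝ[X]) (s t : ℕ) (hs : 0 < s) (hc : t.Coprime s)
    (h : P ^ t = Q ^ s) : ∃ R : ℝ[X], P = R ^ s ∧ Q = R ^ t := by
  have h' : (algebraMap ℝ[X] (RatFunc ℝ) P) ^ t = (algebraMap ℝ[X] (RatFunc ℝ) Q) ^ s := by
    rw [← map_pow, ← map_pow, h]
  obtain ⟨c, h1, h2⟩ := (pow_eq_pow_iff_of_coprime hc).1 h'
  obtain ⟨R, rfl⟩ := IsIntegrallyClosed.exists_algebraMap_eq_of_isIntegral_pow (R := ℝ[X]) hs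
    (x := c) (by rw [← h1]; exact isIntegral_algebraMap)
  refine ⟨R, ?_, ?_⟩
  · apply RatFunc.algebraMap_injective ℝ
    rw [h1, map_pow]
  · apply RatFunc.algebraMap_injective ℝ
    rw [h2, map_pow]

theorem stmt_8 (m μ : ℕ) (hm : 1 < m) (hμ : 1 < μ) (p q : ℝ) (hp : 0 < p) (hq : 0 < q)
    (a : ℕ → ℝ) (h₁ : MemAhat a m p) (h₂ : MemAhat a μ q) :
    MemAhat a (Nat.gcd (m - 1) (μ - 1) + 1)
      ((Nat.gcd (m - 1) (μ - 1) : ℝ) / ((m - 1 : ℕ) : ℝ) * p) := by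
  obtain ⟨M, rfl⟩ : ∃ M, m = M + 1 := ⟨m - 1, by omega⟩
  obtain ⟨N, rfl⟩ : ∃ N, μ = N + 1 := ⟨μ - 1, by omega⟩
  simp only [MemAhat, MemA, Nat.add_sub_cancel] at h₁ h₂ ⊢
  obtain ⟨⟨ha, h1⟩, h1'⟩ := h₁
  obtain ⟨⟨-, h2⟩, h2'⟩ := h₂
  obtain ⟨P, hP, hPf⟩ := (hat_iff _ M).1 ⟨h1, h1'⟩
  obtain ⟨Q, hQ, hQf⟩ := (hat_iff _ N).1 ⟨h2, h2'⟩
  rw [and_assoc]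
  refine ⟨ha, (hat_iff _ _).2 ?_⟩
  -- exponents
  obtain ⟨c, hc, hct⟩ := asymp_rpow a ha p q P M hP hPf
  obtain ⟨e, he, het⟩ := asymp_rpow a ha q p Q N hQ hQf
  rw [mul_comm q p] at het
  have hexp : (M : ℝ) * q = N * p :=
    le_antisymm (exponent_aux _ _ _ c e hc he hct het) (exponent_aux _ _ _ e c he hc het hct)
  have hM : 0 < M := by omega
  have hN : 0 < N := by omega
  have hd : 0 < Nat.gcd M N := Nat.gcd_pos_of_pos_left _ hM
  have hcop := Nat.coprime_div_gcd_div_gcd hd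
  obtain ⟨s, hs⟩ := Nat.gcd_dvd_left M N
  obtain ⟨t, ht⟩ := Nat.gcd_dvd_right M N
  have hs' : M / Nat.gcd M N = s := Nat.div_eq_of_eq_mul_right hd hs
  have ht' : N / Nat.gcd M N = t := Nat.div_eq_of_eq_mul_right hd ht
  rw [hs', ht'] at hcop
  generalize Nat.gcd M N = d at *
  have hs0 : 0 < s := by rcases Nat.eq_zero_or_pos s with h | h; · simp [h] at hs; omega
                         · exact h
  have hd' : (0 : ℝ) < d := by exact_mod_cast hd
  have hsr : (0 : ℝ) < s := by exact_mod_cast hs0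
  have hexp' : p * t = q * s := by
    have : (d : ℝ) * (p * t) = d * (q * s) := by
      rw [hs, ht] at hexp; push_cast at hexp; linarith
    exact mul_left_cancel₀ hd'.ne' this
  have hPQ : P ^ t = Q ^ s := by
    refine poly_ext _ _ fun n => ?_
    rw [eval_pow, eval_pow, ← hPf, ← hQf, ← Real.rpow_mul_natCast (ha n),
      ← Real.rpow_mul_natCast (ha n), hexp']
  obtain ⟨R, hR1, hR2⟩ := exists_root P Q s t hs0 hcop.symm hPQ
  have hRnn : ∀ n : ℕ, 0 ≤ R.eval (n : ℝ) := by
    intro n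
    rcases Nat.even_or_odd s with hse | hso
    · have hto : Odd t := by
        rw [← Nat.not_even_iff_odd]
        intro hte
        have := Nat.dvd_gcd hse.two_dvd hte.two_dvd
        rw [hcop] at this
        omega
      rw [← hto.pow_nonneg_iff, ← eval_pow, ← hR2, ← hQf]
      exact Real.rpow_nonneg (ha n) _
    · rw [← hso.pow_nonneg_iff, ← eval_pow, ← hR1, ← hPf]
      exact Real.rpow_nonneg (ha n) _
  refine ⟨R, ?_, fun n => ?_⟩
  · have hR0 : R ≠ 0 := by
      rintro rfl
      rw [hR1, zero_pow hs0.ne'] at hP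
      simp at hP
    have := natDegree_eq_of_degree_eq_some hP
    rw [hR1, natDegree_pow, hs, mul_comm d s] at this
    rw [degree_eq_natDegree hR0, Nat.eq_of_mul_eq_mul_left hs0 this]
  · have hx : (d : ℝ) / (M : ℝ) * p = p * (s : ℝ)⁻¹ := by
      rw [hs]; push_cast; field_simp
    rw [hx, Real.rpow_mul (ha n), hPf, hR1, eval_pow, Real.pow_rpow_inv_natCast (hRnn n) hs0.ne']
end

section
/- Let T be a bounded linear operator on a Banach space X that is both a strict (m,p)-isometry and a strict (μ,q)-isometry. Then (m-1)·q = (μ-1)·p, and if moreover m > 1 and μ > 1, then T is a strict (d+1, r)-isometry, where d = gcd(m-1, μ-1) and r = (d/(m-1))·p. -/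
/-- `T` is an `(m,p)`-isometry: `∑_{k=0}^{m} (-1)^k (m choose k) ‖T^k x‖^p = 0` for all `x`. -/
def IsMPIsometry {𝕜 X : Type*} [RCLike 𝕜] [NormedAddCommGroup X] [NormedSpace 𝕜 X]
    (T : X →L[𝕜] X) (m : ℕ) (p : ℝ) : Prop :=
  ∀ x : X, ∑ k ∈ Finset.range (m + 1), (-1 : ℝ) ^ k * (m.choose k : ℝ) * ‖(T ^ k) x‖ ^ p = 0

/-- `T` is a strict `(m,p)`-isometry: an `(m,p)`-isometry which, in case `m ≥ 2`,
is not an `(m-1,p)`-isometry. -/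
def IsStrictMPIsometry {𝕜 X : Type*} [RCLike 𝕜] [NormedAddCommGroup X] [NormedSpace 𝕜 X]
    (T : X →L[𝕜] X) (m : ℕ) (p : ℝ) : Prop :=
  IsMPIsometry T m p ∧ (2 ≤ m → ¬ IsMPIsometry T (m - 1) p)

open Polynomial Filter Asymptotics in
theorem aux_sum_eq (a : ℕ → ℝ) (m n : ℕ) :
    ∑ k ∈ Finset.range (m + 1), (-1 : ℝ) ^ k * (m.choose k : ℝ) * a (n + k)
      = (-1) ^ m * ((fwdDiff 1)^[m] a n) := by
  rw [fwdDiff_iter_eq_sum_shift, Finset.mul_sum]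
  refine Finset.sum_congr rfl fun k hk => ?_
  have hk' : k ≤ m := by simpa [Nat.lt_succ_iff] using hk
  obtain ⟨j, rfl⟩ := Nat.exists_eq_add_of_le hk'
  have : ((-1 : ℝ) ^ j) * (-1) ^ j = 1 := by rw [← mul_pow]; simp
  simp only [add_tsub_cancel_left, zsmul_eq_mul, smul_eq_mul, mul_one, pow_add]
  push_cast
  linear_combination (-(-1 : ℝ) ^ k * ((k + j).choose k : ℝ) * a (n + k)) * this

open Polynomial Filter Asymptotics in
theorem aux_poly_of_diff (a : ℕ → ℝ) (m : ℕ) (hm : 1 ≤ m) (h : (fwdDiff 1)^[m] a = 0) :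
    ∃ P : ℝ[X], P.natDegree < m ∧ ∀ n : ℕ, P.eval (n : ℝ) = a n := by
  have hz : ∀ k, m ≤ k → (fwdDiff 1)^[k] a 0 = 0 := by
    intro k hk
    obtain ⟨j, rfl⟩ := Nat.exists_eq_add_of_le hk
    rw [add_comm, Function.iterate_add_apply, h]
    simp [fwdDiff_iter_eq_sum_shift]
  refine ⟨∑ k ∈ Finset.range m, C ((fwdDiff 1)^[k] a 0 / (k.factorial : ℝ)) * descPochhammer ℝ k, ?_, ?_⟩
  · have := natDegree_sum_le_of_forall_le (n := m - 1) (Finset.range m)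
      (fun k => C ((fwdDiff 1)^[k] a 0 / (k.factorial : ℝ)) * descPochhammer ℝ k) (by
        intro k hk
        refine (natDegree_C_mul_le _ _).trans ?_
        rw [descPochhammer_natDegree]
        have := Finset.mem_range.1 hk
        omega)
    omega
  · intro n
    have h1 := shift_eq_sum_fwdDiff_iter 1 a n 0
    simp only [smul_eq_mul, mul_one, zero_add, nsmul_eq_mul] at h1
    have key : ∀ N, m ≤ N → ∑ k ∈ Finset.range m, (n.choose k : ℝ) * (fwdDiff 1)^[k] a 0
        = ∑ k ∈ Finset.range N, (n.choose k : ℝ) * (fwdDiff 1)^[k] a 0 := by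
      intro N hN
      apply Finset.sum_subset (by simpa using hN)
      intro k _ hk
      rw [hz k (by simpa using hk), mul_zero]
    have key2 : ∑ k ∈ Finset.range (n + 1), (n.choose k : ℝ) * (fwdDiff 1)^[k] a 0
        = ∑ k ∈ Finset.range (n + 1 + m), (n.choose k : ℝ) * (fwdDiff 1)^[k] a 0 := by
      apply Finset.sum_subset (by simp)
      intro k _ hk
      rw [Nat.choose_eq_zero_of_lt (by simpa using hk)]
      simp
    rw [h1, key2, ← key _ (by omega), eval_finset_sum]
    refine Finset.sum_congr rfl fun k _ => ?_
    rw [Nat.cast_choose_eq_descPochhammer_div, eval_mul, eval_C]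
    ring

open Polynomial Filter Asymptotics in
theorem aux_iso_iff {𝕜 X : Type*} [RCLike 𝕜] [NormedAddCommGroup X] [NormedSpace 𝕜 X]
    (T : X →L[𝕜] X) (m : ℕ) (hm : 1 ≤ m) (p : ℝ) :
    IsMPIsometry T m p ↔ ∀ x : X, ∃ P : ℝ[X], P.natDegree < m ∧
      ∀ n : ℕ, P.eval (n : ℝ) = ‖(T ^ n) x‖ ^ p := by
  constructor
  · intro h x
    apply aux_poly_of_diff (fun n => ‖(T ^ n) x‖ ^ p) m hm
    funext n
    have h1 := aux_sum_eq (fun n => ‖(T ^ n) x‖ ^ p) m n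
    have h2 := h ((T ^ n) x)
    have h3 : ∀ k, (T ^ k) ((T ^ n) x) = (T ^ (n + k)) x := by
      intro k
      rw [add_comm, pow_add]; rfl
    simp only [h3] at h2
    rw [h2] at h1
    simpa using h1.symm
  · intro h x
    obtain ⟨P, hP, hx⟩ := h x
    have h1 := congrFun (Polynomial.fwdDiff_iter_eq_zero_of_degree_lt hP) 0
    rw [fwdDiff_iter_eq_sum_shift] at h1
    have h2 := aux_sum_eq (fun n => ‖(T ^ n) x‖ ^ p) m 0
    simp only [zero_add] at h2
    rw [h2, fwdDiff_iter_eq_sum_shift]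
    simp only [zero_add, nsmul_eq_mul, mul_one, smul_eq_mul, hx, Pi.zero_apply, Nat.cast_id] at h1 ⊢
    rw [h1, mul_zero]

theorem aux_poly_ext (P Q : Polynomial ℝ) (h : ∀ n : ℕ, P.eval (n : ℝ) = Q.eval (n : ℝ)) :
    P = Q := by
  apply Polynomial.eq_of_infinite_eval_eq
  refine (Set.infinite_range_of_injective (Nat.cast_injective (R := ℝ))).mono ?_
  rintro _ ⟨n, rfl⟩
  exact h n

open Polynomial Filter Asymptotics in
theorem aux_theta (P : ℝ[X]) (hP : P ≠ 0) (hpos : ∀ n : ℕ, 0 ≤ P.eval (n : ℝ)) (s : ℝ) :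
    (fun n : ℕ => P.eval (n : ℝ) ^ s) =Θ[atTop] fun n : ℕ => (n : ℝ) ^ ((P.natDegree : ℝ) * s) := by
  have h1 := (P.isEquivalent_atTop_lead).isTheta
  have h2 : (fun x : ℝ => P.leadingCoeff * x ^ P.natDegree) =Θ[atTop]
      fun x : ℝ => x ^ P.natDegree :=
    (isTheta_const_mul_left (leadingCoeff_ne_zero.2 hP)).2 (isTheta_refl _ _)
  have h3 := (h1.trans h2)
  have h4 : (fun n : ℕ => P.eval (n : ℝ)) =Θ[atTop] fun n : ℕ => (n : ℝ) ^ P.natDegree :=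
    ⟨h3.1.comp_tendsto tendsto_natCast_atTop_atTop, h3.2.comp_tendsto tendsto_natCast_atTop_atTop⟩
  have h5 := h4.rpow (r := s) (Eventually.of_forall hpos)
    (Eventually.of_forall fun n => by positivity)
  refine h5.trans (EventuallyEq.isTheta (Eventually.of_forall fun n => ?_))
  simp only
  rw [Real.rpow_mul (by positivity), Real.rpow_natCast]

open Filter Asymptotics in
theorem aux_le_of_bigO (s t : ℝ)
    (h : (fun n : ℕ => (n : ℝ) ^ s) =O[atTop] fun n : ℕ => (n : ℝ) ^ t) : s ≤ t := by
  by_contra! hlt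
  have h1 : (fun n : ℕ => (n : ℝ) ^ (s - t)) =O[atTop] fun _ : ℕ => (1 : ℝ) := by
    have := h.mul (isBigO_refl (fun n : ℕ => (n : ℝ) ^ (-t)) atTop)
    refine this.congr' ?_ ?_
    · filter_upwards [eventually_gt_atTop 0] with n hn
      rw [← Real.rpow_add (by exact_mod_cast hn), sub_eq_add_neg]
    · filter_upwards [eventually_gt_atTop 0] with n hn
      rw [← Real.rpow_add (by exact_mod_cast hn)]
      simp
  have h2 : Tendsto (fun n : ℕ => (n : ℝ) ^ (s - t)) atTop atTop :=
    (tendsto_rpow_atTop (sub_pos.2 hlt)).comp tendsto_natCast_atTop_atTop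
  obtain ⟨c, hc⟩ := h1.bound
  obtain ⟨n, hn, hn'⟩ := (hc.and (h2.eventually_gt_atTop c)).exists
  have := le_abs_self ((n : ℝ) ^ (s - t))
  simp only [Real.norm_eq_abs, abs_one, mul_one] at hn
  linarith

open Polynomial in
theorem aux_degree (P Q : ℝ[X]) (t : ℕ → ℝ) (ht : ∀ n, 0 ≤ t n) (p q : ℝ) (hp : 0 < p) (hq : 0 < q)
    (hP : ∀ n : ℕ, P.eval (n : ℝ) = t n ^ p) (hQ : ∀ n : ℕ, Q.eval (n : ℝ) = t n ^ q) :
    (P.natDegree : ℝ) * q = (Q.natDegree : ℝ) * p := by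
  have hz : P = 0 ↔ Q = 0 := by
    constructor
    · rintro rfl
      apply aux_poly_ext
      intro n
      have := hP n
      rw [eval_zero, eq_comm, Real.rpow_eq_zero (ht n) hp.ne'] at this
      rw [hQ, this, Real.zero_rpow hq.ne', eval_zero]
    · rintro rfl
      apply aux_poly_ext
      intro n
      have := hQ n
      rw [eval_zero, eq_comm, Real.rpow_eq_zero (ht n) hq.ne'] at this
      rw [hP, this, Real.zero_rpow hp.ne', eval_zero]
  by_cases h0 : P = 0
  · simp [h0, hz.1 h0]
  have h1 := aux_theta P h0 (fun n => by rw [hP]; exact Real.rpow_nonneg (ht n) _) q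
  have h2 := aux_theta Q (fun h => h0 (hz.2 h))
    (fun n => by rw [hQ]; exact Real.rpow_nonneg (ht n) _) p
  have h3 : (fun n : ℕ => P.eval (n : ℝ) ^ q) = fun n : ℕ => Q.eval (n : ℝ) ^ p := by
    funext n
    rw [hP, hQ, ← Real.rpow_mul (ht n), ← Real.rpow_mul (ht n), mul_comm]
  rw [h3] at h1
  have h4 := h1.symm.trans h2
  exact le_antisymm (aux_le_of_bigO _ _ h4.1) (aux_le_of_bigO _ _ h4.2)

open Polynomial in
theorem aux_root (P Q : ℝ[X]) (a b : ℕ) (ha : 0 < a) (hab : b.Coprime a) (h : P ^ b = Q ^ a) :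
    ∃ R : ℝ[X], P = R ^ a ∧ Q = R ^ b := by
  have hinj := IsFractionRing.injective ℝ[X] (FractionRing ℝ[X])
  have h' : (algebraMap ℝ[X] (FractionRing ℝ[X]) P) ^ b
      = (algebraMap ℝ[X] (FractionRing ℝ[X]) Q) ^ a := by
    rw [← map_pow, h, map_pow]
  obtain ⟨c, hc1, hc2⟩ := (pow_eq_pow_iff_of_coprime hab).1 h'
  obtain ⟨R, rfl⟩ := IsIntegrallyClosed.exists_algebraMap_eq_of_isIntegral_pow (R := ℝ[X]) ha
    (x := c) (hc1 ▸ isIntegral_algebraMap)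
  exact ⟨R, hinj (by rw [hc1, map_pow]), hinj (by rw [hc2, map_pow])⟩

open Polynomial in
theorem aux_strict {𝕜 X : Type*} [RCLike 𝕜] [NormedAddCommGroup X] [NormedSpace 𝕜 X]
    (T : X →L[𝕜] X) (m : ℕ) (hm : 2 ≤ m) (p : ℝ) (h : IsStrictMPIsometry T m p) :
    ∃ (x : X) (P : ℝ[X]), P.natDegree = m - 1 ∧ ∀ n : ℕ, P.eval (n : ℝ) = ‖(T ^ n) x‖ ^ p := by
  by_contra! hcon
  refine h.2 hm ((aux_iso_iff T (m - 1) (by omega) p).2 fun x => ?_)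
  obtain ⟨P, hP, hx⟩ := (aux_iso_iff T m (by omega) p).1 h.1 x
  refine ⟨P, ?_, hx⟩
  by_contra hd
  obtain ⟨n, hn⟩ := hcon x P (by omega)
  exact hn (hx n)

theorem aux_le {𝕜 X : Type*} [RCLike 𝕜] [NormedAddCommGroup X] [NormedSpace 𝕜 X]
    (T : X →L[𝕜] X) (m μ : ℕ) (hm : 1 ≤ m) (hμ : 1 ≤ μ)
    (p q : ℝ) (hp : 0 < p) (hq : 0 < q)
    (h₁ : IsStrictMPIsometry T m p) (h₂ : IsStrictMPIsometry T μ q) :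
    ((m - 1 : ℕ) : ℝ) * q ≤ ((μ - 1 : ℕ) : ℝ) * p := by
  rcases hm.eq_or_lt with rfl | hm
  · simp; positivity
  obtain ⟨x, P, hP, hx⟩ := aux_strict T m hm p h₁
  obtain ⟨Q, hQ, hx'⟩ := (aux_iso_iff T μ hμ q).1 h₂.1 x
  have := aux_degree P Q (fun n => ‖(T ^ n) x‖) (fun n => norm_nonneg _) p q hp hq hx hx'
  rw [← hP, this]
  have : Q.natDegree ≤ μ - 1 := by omega
  gcongr

theorem stmt_12 {𝕜 X : Type*} [RCLike 𝕜] [NormedAddCommGroup X] [NormedSpace 𝕜 X]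
    [CompleteSpace X] (T : X →L[𝕜] X) (m μ : ℕ) (hm : 1 ≤ m) (hμ : 1 ≤ μ)
    (p q : ℝ) (hp : 0 < p) (hq : 0 < q)
    (h₁ : IsStrictMPIsometry T m p) (h₂ : IsStrictMPIsometry T μ q) :
    ((m - 1 : ℕ) : ℝ) * q = ((μ - 1 : ℕ) : ℝ) * p ∧
    (1 < m → 1 < μ →
      IsStrictMPIsometry T (Nat.gcd (m - 1) (μ - 1) + 1)
        ((Nat.gcd (m - 1) (μ - 1) : ℝ) / ((m - 1 : ℕ) : ℝ) * p)) := by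
  have heq := le_antisymm (aux_le T m μ hm hμ p q hp hq h₁ h₂) (aux_le T μ m hμ hm q p hq hp h₂ h₁)
  refine ⟨heq, fun hm1 hμ1 => ?_⟩
  have hmpos : 0 < m - 1 := by omega
  have hdpos : 0 < Nat.gcd (m - 1) (μ - 1) := Nat.gcd_pos_of_pos_left _ hmpos
  obtain ⟨a, b, hab, ha, hb⟩ := Nat.exists_coprime (m - 1) (μ - 1)
  generalize Nat.gcd (m - 1) (μ - 1) = d at *
  have ha0 : 0 < a := by
    rcases Nat.eq_zero_or_pos a with rfl | h
    · simp at ha; omega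
    · exact h
  have hdR : (0 : ℝ) < d := by exact_mod_cast hdpos
  have haR : (0 : ℝ) < a := by exact_mod_cast ha0
  have hr : (d : ℝ) / ((m - 1 : ℕ) : ℝ) * p = p / a := by
    rw [ha]; push_cast; field_simp
  have hpq : (a : ℝ) * q = b * p := by
    rw [ha, hb] at heq
    push_cast at heq
    have : (d : ℝ) * (a * q - b * p) = 0 := by linarith
    rcases mul_eq_zero.1 this with h | h <;> linarith
  rw [hr]
  -- the r-th power is the a-th root of the p-th power
  have hroot : ∀ t : ℝ, 0 ≤ t → (t ^ (p / a)) ^ a = t ^ p := by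
    intro t ht
    rw [← Real.rpow_natCast, ← Real.rpow_mul ht, div_mul_cancel₀ _ haR.ne']
  constructor
  · refine (aux_iso_iff T (d + 1) (by omega) _).2 fun x => ?_
    obtain ⟨P, hP, hx⟩ := (aux_iso_iff T m hm p).1 h₁.1 x
    obtain ⟨Q, hQ, hx'⟩ := (aux_iso_iff T μ hμ q).1 h₂.1 x
    have hPQ : P ^ b = Q ^ a := by
      apply aux_poly_ext
      intro n
      rw [Polynomial.eval_pow, Polynomial.eval_pow, hx, hx', ← Real.rpow_natCast,
        ← Real.rpow_natCast, ← Real.rpow_mul (norm_nonneg _), ← Real.rpow_mul (norm_nonneg _),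
        mul_comm q, hpq, mul_comm p]
    obtain ⟨R, hR1, hR2⟩ := aux_root P Q a b ha0 hab.symm hPQ
    refine ⟨R, ?_, fun n => ?_⟩
    · have : P.natDegree = a * R.natDegree := by rw [hR1, Polynomial.natDegree_pow]
      have h3 : a * R.natDegree ≤ a * d := by
        rw [← this, ← ha]; omega
      have := Nat.le_of_mul_le_mul_left h3 ha0
      omega
    · have e1 : (R.eval (n : ℝ)) ^ a = ‖(T ^ n) x‖ ^ p := by
        rw [← Polynomial.eval_pow, ← hR1, hx]
      have e2 : (R.eval (n : ℝ)) ^ b = ‖(T ^ n) x‖ ^ q := by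
        rw [← Polynomial.eval_pow, ← hR2, hx']
      have hnn : 0 ≤ R.eval (n : ℝ) := by
        rcases Nat.even_or_odd a with hev | hodd
        · have hbo : Odd b := by
            rw [← Nat.not_even_iff_odd]
            intro hbe
            have := Nat.dvd_gcd hev.two_dvd hbe.two_dvd
            rw [hab] at this
            omega
          rw [← hbo.pow_nonneg_iff, e2]
          positivity
        · rw [← hodd.pow_nonneg_iff, e1]
          positivity
      refine (pow_left_inj₀ hnn (by positivity) ha0.ne').1 ?_
      rw [e1, hroot _ (norm_nonneg _)]
  · intro hd2 hiso
    rw [Nat.add_sub_cancel] at hiso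
    obtain ⟨x, P, hP, hx⟩ := aux_strict T m hm1 p h₁
    obtain ⟨S, hS, hxS⟩ := (aux_iso_iff T d hdpos _).1 hiso x
    have hPS : P = S ^ a := by
      apply aux_poly_ext
      intro n
      rw [Polynomial.eval_pow, hx, hxS, hroot _ (norm_nonneg _)]
    have h4 : P.natDegree = a * S.natDegree := by rw [hPS, Polynomial.natDegree_pow]
    have h5 : a * S.natDegree < a * d := Nat.mul_lt_mul_of_pos_left hS ha0
    rw [← h4, hP, ← ha] at h5
    exact lt_irrefl _ h5
end

section
/- Let T be a bounded linear operator on a Banach space (X, ‖·‖) that is an (m,∞)-isometry. Then there exists a norm |·| on X equivalent to ‖·‖ (i.e. there exists C > 0 such that ‖x‖ ≤ |x| ≤ C·‖x‖ for all x ∈ X) under which T is an isometry, i.e. |Tx| = |x| for all x ∈ X. -/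
/-- T is an (m,∞)-isometry: for every x, the maximum of the norms of T^k x over even
k in {0,...,m} equals the maximum over odd k in {0,...,m}. -/
def IsMInfIsometry {𝕜 X : Type*} [RCLike 𝕜] [NormedAddCommGroup X] [NormedSpace 𝕜 X]
    (T : X →L[𝕜] X) (m : ℕ) : Prop :=
  ∀ x : X,
    (((Finset.range (m + 1)).filter fun k => Even k).sup fun k => ‖(T ^ k) x‖₊) =
    (((Finset.range (m + 1)).filter fun k => Odd k).sup fun k => ‖(T ^ k) x‖₊)

theorem stmt_14 {𝕜 X : Type*} [RCLike 𝕜] [NormedAddCommGroup X] [NormedSpace 𝕜 X]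
    [CompleteSpace X] (T : X →L[𝕜] X) (m : ℕ) (hm : 1 ≤ m) (hT : IsMInfIsometry T m) :
    ∃ N : X → ℝ, (∀ x : X, N x = 0 ↔ x = 0) ∧
      (∀ x y : X, N (x + y) ≤ N x + N y) ∧
      (∀ (c : 𝕜) (x : X), N (c • x) = ‖c‖ * N x) ∧
      (∃ C : ℝ, 0 < C ∧ ∀ x : X, ‖x‖ ≤ N x ∧ N x ≤ C * ‖x‖) ∧
      ∀ x : X, N (T x) = N x := by
  have key : ∀ x : X, ((Finset.range m).sup fun k => ‖(T ^ k) (T x)‖₊) =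
      (Finset.range m).sup fun k => ‖(T ^ k) x‖₊ := by
    intro x
    have hx := hT x
    have hs : ∀ k, (T ^ k) (T x) = (T ^ (k + 1)) x := fun k => by
      rw [pow_succ]; rfl
    simp only [hs]
    apply le_antisymm
    · apply Finset.sup_le
      intro k hk
      rw [Finset.mem_range] at hk
      by_cases hkm : k + 1 < m
      · exact Finset.le_sup (f := fun k => ‖(T ^ k) x‖₊) (Finset.mem_range.2 hkm)
      · have hkm' : k + 1 = m := by omega
        rw [hkm']
        rcases Nat.even_or_odd m with he | ho
        · have h1 := Finset.le_sup (s := (Finset.range (m + 1)).filter fun k => Even k)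
            (f := fun k => ‖(T ^ k) x‖₊) (b := m) (by simp [he])
          rw [hx] at h1
          refine h1.trans (Finset.sup_mono ?_)
          intro j hj
          simp only [Finset.mem_filter, Finset.mem_range] at hj ⊢
          grind
        · have h1 := Finset.le_sup (s := (Finset.range (m + 1)).filter fun k => Odd k)
            (f := fun k => ‖(T ^ k) x‖₊) (b := m) (by simp [ho])
          rw [← hx] at h1
          refine h1.trans (Finset.sup_mono ?_)
          intro j hj
          simp only [Finset.mem_filter, Finset.mem_range] at hj ⊢
          grind
    · apply Finset.sup_le
      intro k hk
      rw [Finset.mem_range] at hk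
      rcases k with _ | k
      · have h1 := Finset.le_sup (s := (Finset.range (m + 1)).filter fun k => Even k)
            (f := fun k => ‖(T ^ k) x‖₊) (b := 0) (by simp)
        rw [hx] at h1
        refine h1.trans (Finset.sup_le ?_)
        intro j hj
        simp only [Finset.mem_filter, Finset.mem_range] at hj
        rcases j with _ | j
        · simp at hj
        · exact Finset.le_sup (f := fun k => ‖(T ^ (k + 1)) x‖₊) (Finset.mem_range.2 (by omega))
      · exact Finset.le_sup (f := fun k => ‖(T ^ (k + 1)) x‖₊) (Finset.mem_range.2 (by omega))
  have hlow : ∀ x : X, ‖x‖₊ ≤ (Finset.range m).sup fun k => ‖(T ^ k) x‖₊ := fun x => by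
    have h := Finset.le_sup (s := Finset.range m) (f := fun k => ‖(T ^ k) x‖₊) (b := 0)
      (Finset.mem_range.2 (by omega))
    simpa using h
  refine ⟨fun x => (((Finset.range m).sup fun k => ‖(T ^ k) x‖₊ : NNReal) : ℝ),
    ?_, ?_, ?_, ⟨(((Finset.range m).sup fun k => ‖T ^ k‖₊ : NNReal) : ℝ) + 1, by positivity, ?_⟩, ?_⟩
  · intro x
    constructor
    · intro h
      have h2 := hlow x
      rw [NNReal.coe_eq_zero] at h
      rw [h] at h2
      simpa using h2
    · rintro rfl
      simp
  · intro x y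
    rw [← NNReal.coe_add, NNReal.coe_le_coe]
    apply Finset.sup_le
    intro k hk
    rw [map_add]
    exact (nnnorm_add_le _ _).trans (add_le_add
      (Finset.le_sup (f := fun k => ‖(T ^ k) x‖₊) hk)
      (Finset.le_sup (f := fun k => ‖(T ^ k) y‖₊) hk))
  · intro c x
    rw [← coe_nnnorm, ← NNReal.coe_mul, NNReal.mul_finset_sup]
    simp [nnnorm_smul]
  · intro x
    refine ⟨by exact_mod_cast hlow x, ?_⟩
    rw [← coe_nnnorm]
    beta_reduce
    norm_cast
    apply Finset.sup_le
    intro k hk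
    refine ((T ^ k).le_opNNNorm x).trans ?_
    gcongr
    exact (Finset.le_sup (f := fun k => ‖T ^ k‖₊) hk).trans (by simp)
  · intro x
    exact congrArg _ (key x)
end
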